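/- arXiv:1608.07299 — 4 statements merged into one kernel-verified Lean document; each statement's English description precedes it below -/
import Mathlib

section
/- Let e be a no-signalling possibilistic (2,k,2) empirical model. Then e is logically nonlocal if and only if e contains a Hardy paradox. -/
/-- A possibilistic (2,k,l) empirical model is no-signalling. -/
def NoSignalling {k l : ℕ} (e : Fin k → Fin k → Fin l → Fin l → Prop) : Prop :=
  (∀ x y y' a, (∃ b, e x y a b) → ∃ b, e x y' a b) ∧
  (∀ y x x' b, (∃ a, e x y a b) → ∃ a, e x' y a b)

/-- A possibilistic (2,k,l) empirical model is local. -/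
def IsLocal {k l : ℕ} (e : Fin k → Fin k → Fin l → Fin l → Prop) : Prop :=
  ∀ x y a b, e x y a b → ∃ f g : Fin k → Fin l, f x = a ∧ g y = b ∧
    ∀ x' y', e x' y' (f x') (g y')

/-- A possibilistic (2,k,2) empirical model contains a Hardy paradox. -/
def ContainsHardy {k : ℕ} (e : Fin k → Fin k → Fin 2 → Fin 2 → Prop) : Prop :=
  ∃ x₀ x₁ y₀ y₁ : Fin k, x₀ ≠ x₁ ∧ y₀ ≠ y₁ ∧ ∃ a₀ b₀ a₁ b₁ : Fin 2,
    e x₀ y₀ a₀ b₀ ∧ ¬ e x₀ y₁ a₀ b₁ ∧ ¬ e x₁ y₀ a₁ b₀ ∧ ¬ e x₁ y₁ (1 - a₁) (1 - b₁)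

/-- Compatibility of two local outcomes of the first party. -/
def Compat {k : ℕ} (e : Fin k → Fin k → Fin 2 → Fin 2 → Prop)
    (x : Fin k) (a : Fin 2) (x' : Fin k) (a' : Fin 2) : Prop :=
  ∀ y, ∃ b, e x y a b ∧ e x' y a' b

/-- The absence of Hardy paradoxes, without distinctness conditions. -/
def NoHardy {k : ℕ} (e : Fin k → Fin k → Fin 2 → Fin 2 → Prop) : Prop :=
  ∀ x₀ x₁ y₀ y₁ a₀ b₀ a₁ b₁ a₂ b₂, e x₀ y₀ a₀ b₀ → ¬ e x₀ y₁ a₀ b₁ → ¬ e x₁ y₀ a₁ b₀ →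
    a₂ ≠ a₁ → b₂ ≠ b₁ → e x₁ y₁ a₂ b₂

theorem fin2_eq {a b c : Fin 2} (h : a ≠ c) (h' : b ≠ c) : a = b := by omega

theorem fin2_sub (a : Fin 2) : 1 - a ≠ a := by revert a; decide

theorem helly2 {ι : Type*} (Q : ι → Fin 2 → Prop) (h : ∀ i j, ∃ c, Q i c ∧ Q j c) :
    ∃ c, ∀ i, Q i c := by
  by_contra hc
  push Not at hc
  obtain ⟨i, hi⟩ := hc 0
  obtain ⟨j, hj⟩ := hc 1
  obtain ⟨c, h1, h2⟩ := h i j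
  rcases (by omega : c = 0 ∨ c = 1) with rfl | rfl
  · exact hi h1
  · exact hj h2

theorem noHardy_of {k : ℕ} {e : Fin k → Fin k → Fin 2 → Fin 2 → Prop}
    (hns : NoSignalling e) (h : ¬ ContainsHardy e) : NoHardy e := by
  intro x₀ x₁ y₀ y₁ a₀ b₀ a₁ b₁ a₂ b₂ h0 h1 h2 ha hb
  obtain rfl : a₂ = 1 - a₁ := fin2_eq ha (fin2_sub _)
  obtain rfl : b₂ = 1 - b₁ := fin2_eq hb (fin2_sub _)
  by_cases hx : x₀ = x₁
  · subst hx
    have hne : a₀ ≠ a₁ := by rintro rfl; exact h2 h0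
    obtain rfl := fin2_eq hne ha
    obtain ⟨b, hb'⟩ := hns.1 x₀ y₀ y₁ _ ⟨_, h0⟩
    have : b ≠ b₁ := by rintro rfl; exact h1 hb'
    obtain rfl := fin2_eq this hb
    exact hb'
  by_cases hy : y₀ = y₁
  · subst hy
    have hne : b₀ ≠ b₁ := by rintro rfl; exact h1 h0
    obtain rfl := fin2_eq hne hb
    obtain ⟨a, ha'⟩ := hns.2 y₀ x₀ x₁ _ ⟨_, h0⟩
    have : a ≠ a₁ := by rintro rfl; exact h2 ha'
    obtain rfl := fin2_eq this ha
    exact ha'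
  by_contra h3
  exact h ⟨x₀, x₁, y₀, y₁, hx, hy, a₀, b₀, a₁, b₁, h0, h1, h2, h3⟩

theorem bad {k : ℕ} {e : Fin k → Fin k → Fin 2 → Fin 2 → Prop}
    (hns : NoSignalling e) {x x' a a' y₁ b₁ y₂ b₂} (h1 : e x y₁ a b₁) (h2 : e x' y₂ a' b₂)
    (h : ¬ Compat e x a x' a') :
    ∃ y b b', b ≠ b' ∧ e x y a b ∧ ¬ e x y a b' ∧ ¬ e x' y a' b := by
  unfold Compat at h
  push Not at h
  obtain ⟨y, hy⟩ := h
  obtain ⟨b, hb⟩ := hns.1 x y₁ y _ ⟨_, h1⟩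
  obtain ⟨b', hb'⟩ := hns.1 x' y₂ y _ ⟨_, h2⟩
  refine ⟨y, b, b', ?_, hb, fun h => hy _ h hb', hy _ hb⟩
  rintro rfl
  exact hy _ hb hb'

theorem path1 {k : ℕ} {e : Fin k → Fin k → Fin 2 → Fin 2 → Prop}
    (hns : NoSignalling e) (H : NoHardy e) {x y a b} (h : e x y a b) (x' : Fin k) :
    ∃ a', e x' y a' b ∧ Compat e x a x' a' := by
  obtain ⟨c, hc⟩ := hns.2 y x x' _ ⟨_, h⟩
  by_cases hP : Compat e x a x' c
  · exact ⟨c, hc, hP⟩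
  obtain ⟨y1, b1, b1', hne, h1, h2, h3⟩ := bad hns h hc hP
  have hcc := fin2_sub c
  by_cases hd : e x' y (1 - c) b
  · by_cases hP' : Compat e x a x' (1 - c)
    · exact ⟨_, hd, hP'⟩
    obtain ⟨y2, b2, b2', hne', h1', h2', h3'⟩ := bad hns h hd hP'
    exact absurd (H _ _ _ _ _ _ _ _ _ _ h1 h2' h3 hcc hne') h3'
  · exact absurd (H _ _ _ _ _ _ _ _ _ _ h h2 hd hcc.symm hne) h3

theorem path2 {k : ℕ} {e : Fin k → Fin k → Fin 2 → Fin 2 → Prop}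
    (hns : NoSignalling e) (H : NoHardy e) {x a x' a'} (h : Compat e x a x' a') (w : Fin k) :
    ∃ c, Compat e x a w c ∧ Compat e x' a' w c := by
  obtain ⟨b, hb, hb'⟩ := h x
  obtain ⟨c1, hc1, hP1⟩ := path1 hns H hb w
  by_cases hP : Compat e x' a' w c1
  · exact ⟨_, hP1, hP⟩
  obtain ⟨y', b1, b1', hne, h1, h2, h3⟩ := bad hns hb' hc1 hP
  obtain ⟨c2, hc2, hP2⟩ := path1 hns H h1 w
  have hcc : c2 ≠ c1 := by rintro rfl; exact h3 hc2
  by_cases hP' : Compat e x a w c2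
  · exact ⟨_, hP', hP2⟩
  obtain ⟨y, b2, b2', hne', h1', h2', h3'⟩ := bad hns hb hc2 hP'
  obtain ⟨d, hd, hd'⟩ := h y'
  have : d ≠ b1' := by rintro rfl; exact h2 hd'
  obtain rfl := fin2_eq this hne
  exact absurd (H _ _ _ _ _ _ _ _ _ _ hd h2' h3 hcc hne') h3'

theorem compat_symm {k : ℕ} {e : Fin k → Fin k → Fin 2 → Fin 2 → Prop}
    {x a x' a'} (h : Compat e x a x' a') : Compat e x' a' x a :=
  fun y => let ⟨b, h1, h2⟩ := h y; ⟨b, h2, h1⟩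

theorem compat_self {k : ℕ} {e : Fin k → Fin k → Fin 2 → Fin 2 → Prop}
    (hns : NoSignalling e) {x y a b} (h : e x y a b) : Compat e x a x a := fun y' =>
  let ⟨b', h'⟩ := hns.1 x y y' _ ⟨_, h⟩
  ⟨b', h', h'⟩

theorem extend {k : ℕ} {e : Fin k → Fin k → Fin 2 → Fin 2 → Prop}
    (hns : NoSignalling e) (H : NoHardy e) {x₀ y₀ a b} (h : e x₀ y₀ a b) (s : Finset (Fin k)) :
    ∃ f : Fin k → Fin 2, f x₀ = a ∧ e x₀ y₀ (f x₀) b ∧ (∀ x ∈ s, e x y₀ (f x) b) ∧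
      ∀ x ∈ insert x₀ s, ∀ x' ∈ insert x₀ s, Compat e x (f x) x' (f x') := by
  classical
  induction s using Finset.induction_on with
  | empty =>
    refine ⟨fun _ => a, rfl, h, by simp, ?_⟩
    simpa using compat_self hns h
  | insert w s hw ih =>
    obtain ⟨f, hf0, hf1, hf2, hf3⟩ := ih
    by_cases hw0 : w = x₀
    · subst hw0
      refine ⟨f, hf0, hf1, ?_, by simpa using hf3⟩
      intro x hx
      rcases Finset.mem_insert.1 hx with rfl | hx
      · exact hf1
      · exact hf2 x hx
    have hf2' : ∀ x ∈ insert x₀ s, e x y₀ (f x) b := by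
      intro x hx
      rcases Finset.mem_insert.1 hx with rfl | hx
      · exact hf1
      · exact hf2 x hx
    obtain ⟨c, hc⟩ := helly2
      (fun (i : Option {x // x ∈ insert x₀ s}) c => match i with
        | none => e w y₀ c b
        | some x => Compat e x.1 (f x.1) w c) (by
      rintro (_ | ⟨x, hx⟩) (_ | ⟨x', hx'⟩)
      · obtain ⟨c, hc⟩ := hns.2 y₀ x₀ w _ ⟨_, h⟩
        exact ⟨c, hc, hc⟩
      · exact path1 hns H (hf2' _ hx') w
      · obtain ⟨c, h1, h2⟩ := path1 hns H (hf2' _ hx) w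
        exact ⟨c, h2, h1⟩
      · exact path2 hns H (hf3 _ hx _ hx') w)
    have hcn : e w y₀ c b := hc none
    have hcs : ∀ x ∈ insert x₀ s, Compat e x (f x) w c := fun x hx => hc (some ⟨x, hx⟩)
    have hwi : w ∉ insert x₀ s := by simp [hw0, hw]
    have hfu : ∀ x ∈ insert x₀ s, Function.update f w c x = f x := by
      intro x hx
      apply Function.update_of_ne
      rintro rfl
      exact hwi hx
    have hx0 := hfu x₀ (by simp)
    refine ⟨Function.update f w c, by rw [hx0, hf0], by rw [hx0]; exact hf1, ?_, ?_⟩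
    · intro x hx
      rcases Finset.mem_insert.1 hx with rfl | hx
      · simpa using hcn
      · rw [hfu x (by simp [hx])]; exact hf2 x hx
    · intro x hx x' hx'
      rw [Finset.insert_comm] at hx hx'
      replace hx := Finset.mem_insert.1 hx
      replace hx' := Finset.mem_insert.1 hx'
      rcases hx with rfl | hx <;> rcases hx' with rfl | hx'
      · simpa using compat_self hns hcn
      · rw [hfu x' hx', Function.update_self]; exact compat_symm (hcs _ hx')
      · rw [hfu x hx, Function.update_self]; exact hcs _ hx
      · rw [hfu x hx, hfu x' hx']; exact hf3 _ hx _ hx'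

/-- a no-signalling (2,k,2) possibilistic empirical model is logically
nonlocal iff it contains a Hardy paradox. -/
theorem stmt_1 {k : ℕ} (e : Fin k → Fin k → Fin 2 → Fin 2 → Prop)
    (hns : NoSignalling e) : ¬ IsLocal e ↔ ContainsHardy e := by
  classical
  constructor
  · intro hl
    by_contra hh
    apply hl
    have H := noHardy_of hns hh
    intro x₀ y₀ a b h
    obtain ⟨f, hf0, -, hf2, hf3⟩ := extend hns H h Finset.univ
    have hg : ∀ y, ∃ c, ∀ x, e x y (f x) c := fun y =>
      helly2 (fun x c => e x y (f x) c) fun x x' => hf3 x (by simp) x' (by simp) y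
    choose g hg using hg
    refine ⟨f, Function.update g y₀ b, hf0, by simp, fun x y => ?_⟩
    by_cases hy : y = y₀
    · subst hy
      simpa using hf2 x (by simp)
    · rw [Function.update_of_ne hy]; exact hg y x
  · rintro ⟨x₀, x₁, y₀, y₁, -, -, a₀, b₀, a₁, b₁, h0, h1, h2, h3⟩ hl
    obtain ⟨f, g, rfl, rfl, hfg⟩ := hl _ _ _ _ h0
    have ha : f x₁ ≠ a₁ := by rintro rfl; exact h2 (hfg _ _)
    have hb : g y₁ ≠ b₁ := by rintro rfl; exact h1 (hfg _ _)
    rw [← fin2_eq ha (fin2_sub _), ← fin2_eq hb (fin2_sub _)] at h3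
    exact h3 (hfg _ _)
end

section
/- Let e be a no-signalling possibilistic (2,2,l) empirical model. Then e is logically nonlocal if and only if e contains a coarse-grained Hardy paradox. -/
/-- A possibilistic (2,k,l) empirical model contains a coarse-grained Hardy paradox. -/
def ContainsCGHardy {k l : ℕ} (e : Fin k → Fin k → Fin l → Fin l → Prop) : Prop :=
  ∃ x₀ x₁ y₀ y₁ : Fin k, x₀ ≠ x₁ ∧ y₀ ≠ y₁ ∧ ∃ a₀ b₀ : Fin l, ∃ S T : Set (Fin l),
    e x₀ y₀ a₀ b₀ ∧ (∀ b ∉ T, ¬ e x₀ y₁ a₀ b) ∧ (∀ a ∉ S, ¬ e x₁ y₀ a b₀) ∧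
    (∀ a ∈ S, ∀ b ∈ T, ¬ e x₁ y₁ a b)

/-- a no-signalling (2,2,l) possibilistic empirical model is logically
nonlocal iff it contains a coarse-grained Hardy paradox. -/
theorem stmt_2 {l : ℕ} (e : Fin 2 → Fin 2 → Fin l → Fin l → Prop)
    (hns : NoSignalling e) : ¬ IsLocal e ↔ ContainsCGHardy e := by
  have key : ∀ x x' : Fin 2, x' = x ∨ x' = x + 1 := by decide
  have hne : ∀ x : Fin 2, x ≠ x + 1 := by decide
  constructor
  · intro h
    unfold IsLocal at h
    push Not at h
    obtain ⟨x, y, a, b, hab, h⟩ := h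
    refine ⟨x, x + 1, y, y + 1, hne x, hne y, a, b,
      {a' | e (x + 1) y a' b}, {b' | e x (y + 1) a b'}, hab,
      fun _ hb => hb, fun _ ha => ha, ?_⟩
    intro a' ha' b' hb' he
    simp only [Set.mem_setOf_eq] at ha' hb'
    obtain ⟨x', y', hn⟩ := h (fun z => if z = x then a else a')
      (fun z => if z = y then b else b') (by simp) (by simp)
    apply hn
    have hx := (hne x).symm
    have hy := (hne y).symm
    rcases key x x' with h1 | h1 <;> rcases key y y' with h2 | h2 <;> subst h1 <;> subst h2
    · simpa using hab
    · simpa only [if_neg hy, if_true] using hb'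
    · simpa only [if_neg hx, if_true] using ha'
    · simpa only [if_neg hx, if_neg hy] using he
  · rintro ⟨x₀, x₁, y₀, y₁, -, -, a, b, S, T, hab, hT, hS, hST⟩ h
    obtain ⟨f, g, rfl, rfl, hfg⟩ := h _ _ _ _ hab
    exact hST (f x₁) (by_contra fun hn => hS _ hn (hfg _ _)) (g y₁)
      (by_contra fun hn => hT _ hn (hfg _ _)) (hfg _ _)
end

section
/- Let e be a possibilistic (n,2,2) empirical model satisfying the n-partite Hardy paradox conditions: e 0⃗ 0⃗ holds, where 0⃗ is the constant-0 function (the all-0 outcome is possible for the all-0 joint measurement); for every i : Fin n, ¬ e δᵢ δᵢ, where δᵢ : Fin n → Fin 2 takes value 1 at i and 0 elsewhere; and ¬ e 1⃗ 0⃗, where 1⃗ is the constant-1 function. Then e is not local. -/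
/-- A possibilistic (n,2,2) empirical model is local: every possible joint outcome is
explained by a consistent global assignment. -/
def IsLocalN {n : ℕ} (e : (Fin n → Fin 2) → (Fin n → Fin 2) → Prop) : Prop :=
  ∀ m o, e m o → ∃ g : Fin n → Fin 2 → Fin 2,
    (∀ m', e m' (fun i => g i (m' i))) ∧ ∀ i, g i (m i) = o i

/-- any possibilistic (n,2,2) empirical model satisfying the n-partite
Hardy paradox conditions is not local. -/
theorem stmt_3 {n : ℕ} (e : (Fin n → Fin 2) → (Fin n → Fin 2) → Prop)
    (h0 : e (fun _ => 0) (fun _ => 0))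
    (h1 : ∀ i : Fin n, ¬ e (fun j => if j = i then 1 else 0) (fun j => if j = i then 1 else 0))
    (h2 : ¬ e (fun _ => 1) (fun _ => 0)) :
    ¬ IsLocalN e := by
  intro hl
  obtain ⟨g, hg, hz⟩ := hl _ _ h0
  have key : ∀ i, g i 1 = 0 := by
    intro i
    by_contra hne
    have h : g i 1 = 1 := by omega
    apply h1 i
    convert hg (fun j => if j = i then 1 else 0) using 2 with j
    by_cases hj : j = i
    · subst hj; simp [h]
    · simpa [hj] using (hz j).symm
  apply h2
  simpa [key] using hg (fun _ => 1)
end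

section
/- Every strongly nonlocal no-signalling probabilistic (2,2,2) empirical model is a PR box up to relabelling: if p is no-signalling and strongly nonlocal, then there exist permutations σ τ of Fin 2 (relabelling the measurements of each party) and families of permutations α β : Fin 2 → Equiv.Perm (Fin 2) (relabelling outcomes per measurement) such that p (σ x) (τ y) (α x a) (β y b) = PR x y a b for all x y a b. -/
/-- The Popescu-Rohrlich box: joint outcome `(a,b)` for measurements `(x,y)` has
probability `1/2` if `a + b = x * y` in `ZMod 2`, and `0` otherwise. -/
noncomputable def PR (x y a b : Fin 2) : ℝ :=
  if ((a.val : ZMod 2) + (b.val : ZMod 2) = (x.val : ZMod 2) * (y.val : ZMod 2))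
  then 1 / 2 else 0


theorem fin2_cases (c x : Fin 2) : c = x ∨ c = x + 1 := by
  revert c x; decide

theorem fin2_succ_ne (x : Fin 2) : x + 1 ≠ x := by
  revert x; decide

/-- Every outcome of every measurement of the first party has positive probability. -/
theorem marg_pos (p : Fin 2 → Fin 2 → Fin 2 → Fin 2 → ℝ)
    (hpos : ∀ x y a b, p x y a b ≥ 0)
    (hsum : ∀ x y, ∑ a : Fin 2, ∑ b : Fin 2, p x y a b = 1)
    (hns1 : ∀ x y y' a, ∑ b : Fin 2, p x y a b = ∑ b : Fin 2, p x y' a b)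
    (hns2 : ∀ y x x' b, ∑ a : Fin 2, p x y a b = ∑ a : Fin 2, p x' y a b)
    (hsnl : ¬ ∃ f g : Fin 2 → Fin 2, ∀ x y, p x y (f x) (g y) > 0) :
    ∀ x y a, ∃ b, p x y a b > 0 := by
  intro x y a
  by_contra! h
  have hz : ∀ y' b, p x y' a b = 0 := by
    intro y' b
    have h1 := hns1 x y y' a
    simp only [Fin.sum_univ_two] at h1
    have := h 0
    have := h 1
    have := hpos x y' a 0
    have := hpos x y' a 1
    fin_cases b <;> simp <;> linarith
  have hrow : ∃ a', ∑ b : Fin 2, p (x + 1) 0 a' b > 0 := by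
    by_contra! h0
    have h1 := hsum (x + 1) 0
    rw [Fin.sum_univ_two] at h1
    linarith [h0 0, h0 1]
  obtain ⟨a', ha'⟩ := hrow
  have hg : ∀ y', ∃ b, p (x + 1) y' a' b > 0 := by
    intro y'
    by_contra! h0
    rw [hns1 (x + 1) 0 y' a', Fin.sum_univ_two] at ha'
    linarith [h0 0, h0 1]
  choose g hg using hg
  apply hsnl
  refine ⟨fun z => if z = x then a + 1 else a', g, ?_⟩
  intro z y'
  rcases fin2_cases z x with rfl | rfl
  · have h1 := hns2 y' z (z + 1) (g y')
    simp only [Fin.sum_univ_two] at h1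
    have h2 := hg y'
    have h3 := hz y' (g y')
    have h4 := hpos (z + 1) y' 0 (g y')
    have h5 := hpos (z + 1) y' 1 (g y')
    simp only [if_true]
    fin_cases a <;> fin_cases a' <;> simp at * <;> linarith
  · have : x + 1 ≠ x := fin2_succ_ne x
    simp only [this, if_false]
    exact hg _

/-- A relation with full projections on both sides contains a bijection. -/
theorem exists_shift (R : Fin 2 → Fin 2 → Prop) (h1 : ∀ a, ∃ b, R a b)
    (h2 : ∀ b, ∃ a, R a b) : ∃ s, ∀ a, R a (a + s) := by
  have e1 := h1 0
  have e2 := h1 1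
  have e3 := h2 0
  have e4 := h2 1
  simp only [Fin.exists_fin_two, Fin.forall_fin_two, zero_add, add_zero] at *
  have : (1 : Fin 2) + 1 = 0 := rfl
  rw [this]
  tauto

/-- every strongly nonlocal no-signalling probabilistic (2,2,2) empirical
model is a PR box up to relabelling of measurements and outcomes. -/
theorem stmt_4 (p : Fin 2 → Fin 2 → Fin 2 → Fin 2 → ℝ)
    (hpos : ∀ x y a b, p x y a b ≥ 0)
    (hsum : ∀ x y, ∑ a : Fin 2, ∑ b : Fin 2, p x y a b = 1)
    (hns1 : ∀ x y y' a, ∑ b : Fin 2, p x y a b = ∑ b : Fin 2, p x y' a b)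
    (hns2 : ∀ y x x' b, ∑ a : Fin 2, p x y a b = ∑ a : Fin 2, p x' y a b)
    (hsnl : ¬ ∃ f g : Fin 2 → Fin 2, ∀ x y, p x y (f x) (g y) > 0) :
    ∃ (σ τ : Equiv.Perm (Fin 2)) (α β : Fin 2 → Equiv.Perm (Fin 2)),
      ∀ x y a b, p (σ x) (τ y) (α x a) (β y b) = PR x y a b := by
  have hL := marg_pos p hpos hsum hns1 hns2 hsnl
  have hR := marg_pos (fun y x b a => p x y a b) (fun _ _ _ _ => hpos _ _ _ _)
    (fun y x => by rw [Finset.sum_comm]; exact hsum x y)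
    (fun y x x' b => hns2 y x x' b) (fun x y y' a => hns1 x y y' a)
    (fun ⟨g, f, h⟩ => hsnl ⟨f, g, fun x y => h y x⟩)
  have hs : ∀ x y, ∃ s, ∀ a, p x y a (a + s) > 0 := fun x y =>
    exists_shift (fun a b => p x y a b > 0) (hL x y) (hR y x)
  choose s hs using hs
  -- the path through the other three contexts never closes up
  have hz : ∀ x y a, p x y a (a + s x (y + 1) + s (x + 1) (y + 1) + s (x + 1) y) = 0 := by
    intro x y a
    by_contra hne
    have hp := lt_of_le_of_ne (hpos _ _ _ _) (Ne.symm hne)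
    apply hsnl
    have hx : x + 1 ≠ x := fin2_succ_ne x
    have hy : y + 1 ≠ y := fin2_succ_ne y
    refine ⟨fun z => if z = x then a else a + s x (y + 1) + s (x + 1) (y + 1),
      fun w => if w = y then a + s x (y + 1) + s (x + 1) (y + 1) + s (x + 1) y
        else a + s x (y + 1), ?_⟩
    intro z w
    rcases fin2_cases z x with rfl | rfl <;> rcases fin2_cases w y with rfl | rfl
    · simpa using hp
    · simpa [hy] using hs _ _ _
    · simpa [hx] using hs _ _ _
    · simp only [hx, hy, if_false]
      have h1 := hs (x + 1) (y + 1) (a + s x (y + 1) + s (x + 1) (y + 1))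
      have h2 : ∀ u v : Fin 2, u + v + v = u := by decide
      rwa [h2] at h1
  -- total parity is odd
  have hodd : s 1 0 + s 0 0 + s 0 1 + s 1 1 = 1 := by
    have h1 := hz 1 1 0
    have h2 := hs 1 1 0
    have key : ∀ u v w t : Fin 2, u + v + w + t = 1 ∨ 0 + u + v + w = 0 + t := by decide
    rcases key (s 1 0) (s 0 0) (s 0 1) (s 1 1) with h | h
    · exact h
    · exact absurd (h ▸ h1) h2.ne'
  have hzero : ∀ x y a, p x y a (a + s x y + 1) = 0 := by
    intro x y a
    have h1 := hz x y a
    rw [← h1]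
    congr 1
    revert hodd
    clear * -
    fin_cases x <;> fin_cases y <;> simp <;> generalize s 0 0 = q <;> generalize s 0 1 = r <;>
      generalize s 1 0 = t <;> generalize s 1 1 = u <;> revert a q r t u <;> decide
  have hhalf : ∀ x y a, p x y a (a + s x y) = 1 / 2 := by
    have a00 := hzero 0 0
    have a01 := hzero 0 1
    have a10 := hzero 1 0
    have a11 := hzero 1 1
    have t00 := hsum 0 0
    have t01 := hsum 0 1
    have t10 := hsum 1 0
    have t11 := hsum 1 1
    have n1 := hns1 0 0 1
    have n2 := hns1 1 0 1
    have n3 := hns2 0 0 1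
    have n4 := hns2 1 0 1
    revert hodd
    simp only [Fin.forall_fin_two, Fin.sum_univ_two] at *
    clear hsnl hs hz hL hR hpos hsum hns1 hns2 hzero
    have e : (1 : Fin 2) + 1 = 0 := rfl
    rcases fin2_cases (s 0 0) 0 with h0 | h0 <;> rcases fin2_cases (s 0 1) 0 with h1 | h1 <;>
    rcases fin2_cases (s 1 0) 0 with h2 | h2 <;> rcases fin2_cases (s 1 1) 0 with h3 | h3 <;>
    simp only [h0, h1, h2, h3, zero_add, add_zero, e] at * <;> intro hodd <;>
    first
    | (exfalso; revert hodd; decide)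
    | (refine ⟨⟨⟨?_, ?_⟩, ⟨?_, ?_⟩⟩, ⟨⟨?_, ?_⟩, ⟨?_, ?_⟩⟩⟩ <;> linarith)
  have hform : ∀ x y a b, p x y a b = if a + b = s x y then 1 / 2 else 0 := by
    intro x y a b
    rcases fin2_cases b (a + s x y) with rfl | rfl
    · have : a + (a + s x y) = s x y := by
        generalize s x y = t; revert a t; decide
      rw [if_pos this, hhalf]
    · have : a + (a + s x y + 1) ≠ s x y := by
        generalize s x y = t; revert a t; decide
      rw [if_neg this, hzero]
  refine ⟨1, 1, fun x => Equiv.addRight (if x = 0 then 0 else s 1 0 + s 0 0),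
    fun y => Equiv.addRight (s 0 y), ?_⟩
  intro x y a b
  rw [hform]
  unfold PR
  congr 1
  revert hodd
  clear * -
  rw [eq_iff_iff]
  fin_cases x <;> fin_cases y <;> simp <;> generalize s 0 0 = q <;> generalize s 0 1 = r <;>
      generalize s 1 0 = t <;> generalize s 1 1 = u <;> revert a b q r t u <;> decide
end
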